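/- Let p ≥ 4 be an integer and L ≥ 0. For every real q with 0 < q < 1, Σ_{m} q^{(m·C̃m)/4} ∏_{j=0}^{p−2} [ (½Ĩm + L e_0)_j choose m_j ]_q = Σ_{j∈ℤ} ( q^{p(p+1)j² + j} T^0(L, 2pj) − q^{(pj+1)((p+1)j+1)} T^0(L, 2pj + 2) ), where the left-hand sum runs over all m ∈ ℤ^{p−1} with nonnegative entries and m_{p−2} even (only finitely many m contribute), and the right-hand sum has only finitely many nonzero terms. -/

import Mathlib

open Finset

noncomputable section

/-- `(q)_k = ∏_{j=1}^k (1 - q^j)`. -/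
def qPoch (q : ℝ) (k : ℕ) : ℝ := ∏ j ∈ Finset.range k, (1 - q ^ (j + 1))

/-- The Andrews–Baxter `q`-trinomial coefficient `T^n(L,A)`. -/
def qTri (q : ℝ) (n : ℤ) (L : ℕ) (A : ℤ) : ℝ :=
  if |A| ≤ (L : ℤ) then
    ∑ j ∈ Finset.range (L + 1),
      if 0 ≤ (j : ℤ) + A ∧ 0 ≤ (L : ℤ) - 2 * j - A then
        q ^ ((j : ℤ) * ((j : ℤ) + A - n)) * qPoch q L /
          (qPoch q j * qPoch q (((j : ℤ) + A).toNat) * qPoch q (((L : ℤ) - 2 * j - A).toNat))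
      else 0
  else 0

/-- Bosonic polynomial `B^p_{a,b}(L,s)`. -/
def Bpoly (q : ℝ) (p a b s : ℤ) (L : ℕ) : ℝ :=
  ∑' j : ℤ,
    (q ^ (p * (p + 1) * j ^ 2 + j * ((p + 1) * a - p * s)) * qTri q 0 L (2 * p * j + a - b)
      - q ^ ((p * j + a) * ((p + 1) * j + s)) * qTri q 0 L (2 * p * j + a + b))

/-- Bosonic polynomial `B̃^p_{a,b}(L,s)`. -/
def Btpoly (q : ℝ) (p a b s : ℤ) (L : ℕ) : ℝ :=
  ∑' j : ℤ,
    (q ^ (p * (p + 1) * j ^ 2 + j * ((p + 1) * a - p * s)) * qTri q 1 L (2 * p * j + a - b)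
      - q ^ (p * (p + 1) * j ^ 2 + j * ((p + 1) * a + p * (s - 2)) + a * (s - 1) - b)
        * qTri q 1 L (2 * p * j + a + b))

/-- `(q)_∞`. -/
def qPochInf (q : ℝ) : ℝ := ∏' j : ℕ, (1 - q ^ (j + 1))

/-- The matrix `Ĩ_{p-1}`. -/
def ItM (p : ℕ) (i j : Fin (p - 1)) : ℚ :=
  if i.val = 0 then (if j.val = 2 then -1 else 0)
  else if j.val = 0 then (if i.val = 2 then 1 else 0)
  else if i.val = j.val + 1 ∨ j.val = i.val + 1 then 1 else 0

/-- The matrix `C̃_{p-1} = 2·Id - Ĩ_{p-1}`. -/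
def CtM (p : ℕ) (i j : Fin (p - 1)) : ℚ := (if i = j then 2 else 0) - ItM p i j

/-- Unit vector `e_c` (zero if `c` is out of range). -/
def evec (p c : ℕ) : Fin (p - 1) → ℚ := fun i => if i.val = c then 1 else 0

/-- Kronecker delta. -/
def kdel (a b : ℕ) : ℕ := if a = b then 1 else 0

/-- `p̃(n) = 1` if `n` is odd, `0` otherwise. -/
def ptil (n : ℕ) : ℚ := if n % 2 = 1 then 1 else 0

/-- The vector `u^i_{a,b}`. -/
def uvec (p i a b : ℕ) : Fin (p - 1) → ℚ := fun j =>
  (if 1 < a then evec p a j else 0) + (if 1 < b then evec p b j else 0)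
    + ptil (a + kdel a 1 + b + kdel b 1 + (if i = 1 then p - 1 else 0)) * (evec p 1 j - evec p 0 j)

/-- The vector `A^i_{a,b}`. -/
def Avec (p i a b : ℕ) : Fin (p - 1) → ℚ := fun j =>
  (if 1 < b then evec p b j else 0)
    + ptil (a + kdel a 1 + b + kdel b 1 + (if i = 1 then p - 1 else 0)) * evec p 1 j

/-- `q`-binomial coefficient with (possibly non-integral) rational top entry:
it vanishes unless the top is an integer `N` with `0 ≤ m ≤ N`. -/
def qBinQ (q : ℝ) (N : ℚ) (m : ℕ) : ℝ :=
  if N.den = 1 ∧ (m : ℚ) ≤ N then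
    qPoch q N.num.toNat / (qPoch q m * qPoch q (N.num.toNat - m))
  else 0

/-- The quadratic form `Φ(m) = (m·C̃m)/4 - (A·m)/2`. -/
def PhiQ (p : ℕ) (A : Fin (p - 1) → ℚ) (m : Fin (p - 1) → ℕ) : ℚ :=
  (∑ i, ∑ j, (m i : ℚ) * CtM p i j * (m j : ℚ)) / 4 - (∑ j, A j * (m j : ℚ)) / 2

/-- The vector `(½ Ĩ m + L e₀ + ½ u)`. -/
def topVec (p L : ℕ) (u : Fin (p - 1) → ℚ) (m : Fin (p - 1) → ℕ) (i : Fin (p - 1)) : ℚ :=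
  (∑ j, ItM p i j * (m j : ℚ)) / 2 + (L : ℚ) * evec p 0 i + u i / 2

/-- The last component `m_{p-2}`. -/
def mlast (p : ℕ) (m : Fin (p - 1) → ℕ) : ℕ :=
  if h : p - 1 ≠ 0 then m ⟨p - 2, by omega⟩ else 0

/-- The fundamental fermionic form `f^p_k(L; u; A)`. -/
def fFerm (q : ℝ) (p k L : ℕ) (u A : Fin (p - 1) → ℚ) : ℝ :=
  ∑' m : Fin (p - 1) → ℕ,
    if mlast p m % 2 = k % 2 then
      q ^ ((PhiQ p A m : ℝ)) * ∏ i, qBinQ q (topVec p L u m i) (m i)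
    else 0

/-- The fermionic polynomial `F^{p,i}_{a,b}(L)`. -/
def Fpoly (q : ℝ) (p i a b L : ℕ) : ℝ :=
  if b = p - 1 then fFerm q p (1 - i) L (uvec p i a b) (Avec p i a b)
  else fFerm q p i L (uvec p i a b) (Avec p i a b)

def phiR (a b : ℝ) : ℝ := (b - a) * (b - a + 1) / 4

def phitR (a b : ℝ) : ℝ := (b - a) * (b - a + 3) / 4

/-- Virasoro character `χ^{p,p+1}_{r,s}(q)` of the minimal model `M(p,p+1)`. -/
def chiV (p r s : ℤ) (q : ℝ) : ℝ :=
  (∑' j : ℤ, (q ^ (p * (p + 1) * j ^ 2 + j * ((p + 1) * r - p * s))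
      - q ^ ((p * j + r) * ((p + 1) * j + s)))) / qPochInf q


/-- Gaussian binomial. -/
def gb (q : ℝ) (n k : ℕ) : ℝ :=
  if k ≤ n then qPoch q n / (qPoch q k * qPoch q (n - k)) else 0

lemma qPoch_ne {q : ℝ} (hq0 : 0 < q) (hq1 : q < 1) (k : ℕ) : qPoch q k ≠ 0 := by
  unfold qPoch
  refine Finset.prod_ne_zero_iff.mpr fun j _ => ?_
  have : q ^ (j + 1) < 1 := pow_lt_one₀ hq0.le hq1 (by omega)
  linarith

lemma qPoch_succ (q : ℝ) (k : ℕ) : qPoch q (k + 1) = qPoch q k * (1 - q ^ (k + 1)) := by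
  unfold qPoch
  rw [Finset.prod_range_succ]

lemma qPoch_zero (q : ℝ) : qPoch q 0 = 1 := by simp [qPoch]

lemma gb_of_lt (q : ℝ) {n k : ℕ} (h : n < k) : gb q n k = 0 := by
  unfold gb
  rw [if_neg (by omega)]

lemma gb_add {q : ℝ} (a b : ℕ) : gb q (a + b) a = qPoch q (a + b) / (qPoch q a * qPoch q b) := by
  unfold gb
  rw [if_pos (by omega), Nat.add_sub_cancel_left]

lemma gb_zero {q : ℝ} (hq0 : 0 < q) (hq1 : q < 1) (n : ℕ) : gb q n 0 = 1 := by
  have := qPoch_ne hq0 hq1 n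
  simp [gb, qPoch_zero, this]

lemma gb_self {q : ℝ} (hq0 : 0 < q) (hq1 : q < 1) (n : ℕ) : gb q n n = 1 := by
  have := qPoch_ne hq0 hq1 n
  simp [gb, qPoch_zero, this]

lemma gb_succ {q : ℝ} (hq0 : 0 < q) (hq1 : q < 1) (n k : ℕ) :
    gb q (n + 1) (k + 1) = gb q n k + q ^ (k + 1) * gb q n (k + 1) := by
  rcases lt_trichotomy n k with h | h | h
  · rw [gb_of_lt q (by omega), gb_of_lt q h, gb_of_lt q (by omega)]; ring
  · subst h
    rw [gb_self hq0 hq1, gb_self hq0 hq1, gb_of_lt q (by omega)]; ring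
  · obtain ⟨d, rfl⟩ : ∃ d, n = k + 1 + d := ⟨n - (k + 1), by omega⟩
    have e1 : k + 1 + d + 1 = (k + 1) + (d + 1) := by ring
    have e2 : gb q (k + 1 + d) k = qPoch q (k + 1 + d) / (qPoch q k * qPoch q (d + 1)) := by
      have : k + 1 + d = k + (d + 1) := by ring
      rw [this, gb_add]
    rw [e2, gb_add, e1, gb_add, ← e1, qPoch_succ q (k + 1 + d), qPoch_succ q d, qPoch_succ q k]
    have h1 := qPoch_ne hq0 hq1 k
    have h2 := qPoch_ne hq0 hq1 d
    have h3 : 1 - q ^ (k + 1) ≠ 0 := by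
      have := qPoch_ne hq0 hq1 (k + 1); rw [qPoch_succ] at this; exact right_ne_zero_of_mul this
    have h4 : 1 - q ^ (d + 1) ≠ 0 := by
      have := qPoch_ne hq0 hq1 (d + 1); rw [qPoch_succ] at this; exact right_ne_zero_of_mul this
    field_simp
    ring

lemma gb_symm {q : ℝ} (a b : ℕ) : gb q (a + b) a = gb q (a + b) b := by
  rw [gb_add, add_comm a b, gb_add, mul_comm]

lemma gb_mul {q : ℝ} (hq0 : 0 < q) (hq1 : q < 1) (n k j : ℕ) (h : j ≤ k) :
    gb q n k * gb q k j = gb q n j * gb q (n - j) (k - j) := by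
  by_cases hk : k ≤ n
  · obtain ⟨c, rfl⟩ := Nat.exists_eq_add_of_le h
    obtain ⟨d, rfl⟩ := Nat.exists_eq_add_of_le hk
    have e1 : j + c + d - j = c + d := by omega
    have e2 : j + c - j = c := by omega
    rw [e1, e2, gb_add, gb_add, gb_add, add_assoc, gb_add]
    have h1 := qPoch_ne hq0 hq1 j
    have h2 := qPoch_ne hq0 hq1 c
    have h3 := qPoch_ne hq0 hq1 d
    have h4 := qPoch_ne hq0 hq1 (j + c)
    have h5 := qPoch_ne hq0 hq1 (c + d)
    field_simp
  · rw [gb_of_lt q (by omega : n < k)]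
    by_cases hj : j ≤ n
    · rw [gb_of_lt q (by omega : n - j < k - j)]; ring
    · rw [gb_of_lt q (by omega : n < j)]; ring

/-- q-Vandermonde. -/
lemma gb_vand {q : ℝ} (hq0 : 0 < q) (hq1 : q < 1) (a b : ℕ) : ∀ c : ℕ,
    ∑ k ∈ Finset.range (c + 1), gb q a k * gb q b (c - k) * q ^ ((a - k) * (c - k))
      = gb q (a + b) c := by
  induction a with
  | zero =>
    intro c
    rw [Finset.sum_eq_single 0]
    · simp [gb_zero hq0 hq1]
    · intro k _ hk
      rw [gb_of_lt q (by omega : 0 < k)]; ring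
    · simp
  | succ a ih =>
    intro c
    cases c with
    | zero => simp [gb_zero hq0 hq1]
    | succ c =>
      rw [show a + 1 + b = a + b + 1 by ring, gb_succ hq0 hq1, ← ih c, ← ih (c + 1),
        Finset.sum_range_succ', Finset.sum_range_succ' _ (c + 1), mul_add, Finset.mul_sum,
        ← add_assoc, ← Finset.sum_add_distrib]
      congr 1
      · refine Finset.sum_congr rfl fun k hk => ?_
        have hk : k < c + 1 := Finset.mem_range.mp hk
        rw [gb_succ hq0 hq1]
        have e1 : c + 1 - (k + 1) = c - k := by omega
        have e2 : a + 1 - (k + 1) = a - k := by omega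
        rw [e1, e2]
        by_cases hka : k + 1 ≤ a
        · have e3 : (a - k) * (c - k) = (a - (k + 1)) * (c - k) + (c - k) := by
            have : a - k = a - (k + 1) + 1 := by omega
            rw [this]; ring
          have e4 : c + 1 = (c - k) + (k + 1) := by omega
          have e5 : q ^ (c + 1) = q ^ (c - k) * q ^ (k + 1) := by rw [← pow_add, ← e4]
          rw [e5, e3, pow_add]
          ring
        · rw [gb_of_lt q (by omega : a < k + 1)]; ring
      · rw [gb_zero hq0 hq1, gb_zero hq0 hq1]
        simp only [Nat.sub_zero]
        rw [show (a + 1) * (c + 1) = a * (c + 1) + (c + 1) by ring, pow_add]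
        ring

/-- q-Vandermonde, reflected. -/
lemma gb_vand' {q : ℝ} (hq0 : 0 < q) (hq1 : q < 1) (a b c : ℕ) :
    ∑ j ∈ Finset.range (c + 1), gb q a (c - j) * gb q b j * q ^ ((a - (c - j)) * j)
      = gb q (a + b) c := by
  rw [← gb_vand hq0 hq1 a b c, ← Finset.sum_range_reflect]
  refine Finset.sum_congr rfl fun k hk => ?_
  have hk : k < c + 1 := Finset.mem_range.mp hk
  have e1 : c + 1 - 1 - k = c - k := by omega
  have e2 : c - (c - k) = k := by omega
  rw [e1, e2]

/-- q-Saalschütz, in the form of Knuth. -/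
lemma gb_knuth {q : ℝ} (hq0 : 0 < q) (hq1 : q < 1) (X Y m n d : ℕ) (h : X + Y = m + n) :
    ∑ k ∈ Finset.range (n + 1),
      gb q X k * gb q Y (n - k) * gb q (m + d + k) (m + n) * q ^ ((n - k) * (X - k))
      = gb q (m + d) m * gb q (X + d) n := by
  have h0 : ∀ k ∈ Finset.range (n + 1), gb q (m + d + k) (m + n) =
      ∑ j ∈ Finset.range (n + 1), gb q (m + d) (m + n - j) * gb q k j * q ^ ((d - (n - j)) * j) := by
    intro k hk
    have hk : k < n + 1 := Finset.mem_range.mp hk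
    rw [← gb_vand' hq0 hq1 (m + d) k (m + n)]
    have hs : Finset.range (n + 1) ⊆ Finset.range (m + n + 1) :=
      Finset.range_subset_range.mpr (by omega)
    rw [← Finset.sum_subset hs]
    · refine Finset.sum_congr rfl fun j hj => ?_
      have hj : j < n + 1 := Finset.mem_range.mp hj
      rw [show m + d - (m + n - j) = d - (n - j) by omega]
    · intro j _ hj
      rw [Finset.mem_range] at hj
      rw [gb_of_lt q (by omega : k < j)]; ring
  have h1 : ∀ k ∈ Finset.range (n + 1),
      gb q X k * gb q Y (n - k) * gb q (m + d + k) (m + n) * q ^ ((n - k) * (X - k))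
      = ∑ j ∈ Finset.range (n + 1),
          gb q X k * gb q k j * gb q (m + d) (m + n - j) * q ^ ((d - (n - j)) * j)
          * gb q Y (n - k) * q ^ ((n - k) * (X - k)) := by
    intro k hk
    rw [h0 k hk, Finset.mul_sum, Finset.sum_mul]
    exact Finset.sum_congr rfl fun j _ => by ring
  rw [Finset.sum_congr rfl h1, Finset.sum_comm]
  have h2 : ∀ j ∈ Finset.range (n + 1), ∑ k ∈ Finset.range (n + 1),
          gb q X k * gb q k j * gb q (m + d) (m + n - j) * q ^ ((d - (n - j)) * j)
          * gb q Y (n - k) * q ^ ((n - k) * (X - k))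
        = gb q (m + d) m * (gb q d (n - j) * gb q X j * q ^ ((d - (n - j)) * j)) := by
    intro j hj
    have hj : j < n + 1 := Finset.mem_range.mp hj
    by_cases hX : j ≤ X
    · have h3 : ∑ k ∈ Finset.range (n + 1),
          gb q X k * gb q k j * gb q Y (n - k) * q ^ ((n - k) * (X - k))
          = gb q X j * gb q (m + n - j) (n - j) := by
        have e : m + n - j = (X - j) + Y := by omega
        rw [e, ← gb_vand hq0 hq1 (X - j) Y (n - j), show n + 1 = j + (n - j + 1) by omega,
          Finset.sum_range_add, Finset.sum_eq_zero, zero_add, Finset.mul_sum]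
        · refine Finset.sum_congr rfl fun k hk => ?_
          have hk : k < n - j + 1 := Finset.mem_range.mp hk
          rw [gb_mul hq0 hq1 X (j + k) j (by omega), show j + k - j = k by omega,
            show n - (j + k) = n - j - k by omega, show X - (j + k) = X - j - k by omega,
            mul_comm (n - j - k)]
          ring
        · intro k hk
          have hk : k < j := Finset.mem_range.mp hk
          rw [gb_of_lt q hk]; ring
      have h4 : gb q (m + d) (m + n - j) * gb q (m + n - j) (n - j)
          = gb q (m + d) m * gb q d (n - j) := by
        have e : m + n - j = m + (n - j) := by omega
        have := gb_mul hq0 hq1 (m + d) (m + n - j) m (by omega)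
        rw [show m + d - m = d by omega, show m + n - j - m = n - j by omega] at this
        rw [← this, e, gb_symm]
      calc _ = gb q (m + d) (m + n - j) * q ^ ((d - (n - j)) * j) *
            ∑ k ∈ Finset.range (n + 1),
              gb q X k * gb q k j * gb q Y (n - k) * q ^ ((n - k) * (X - k)) := by
              rw [Finset.mul_sum]
              exact Finset.sum_congr rfl fun k _ => by ring
        _ = _ := by
              rw [h3]
              linear_combination (gb q X j * q ^ ((d - (n - j)) * j)) * h4
    · rw [gb_of_lt q (by omega : X < j), Finset.sum_eq_zero]
      · ring
      · intro k _
        by_cases hk : k < j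
        · rw [gb_of_lt q hk]; ring
        · rw [gb_of_lt q (by omega : X < k)]; ring
  rw [Finset.sum_congr rfl h2, ← Finset.mul_sum, gb_vand' hq0 hq1, add_comm X d]

/-- Gaussian binomial with integer entries. -/
def zb (q : ℝ) (N m : ℤ) : ℝ := if 0 ≤ m ∧ m ≤ N then gb q N.toNat m.toNat else 0

lemma zb_of (q : ℝ) {N m : ℤ} (h : ¬ (0 ≤ m ∧ m ≤ N)) : zb q N m = 0 := by
  unfold zb; rw [if_neg h]

lemma zb_bd {q : ℝ} {N m : ℤ} (h : zb q N m ≠ 0) : 0 ≤ m ∧ m ≤ N := by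
  by_contra hh; exact h (zb_of q hh)

lemma zb_nat (q : ℝ) (N m : ℕ) : zb q (N : ℤ) (m : ℤ) = gb q N m := by
  unfold zb
  split_ifs with h
  · simp
  · rw [gb_of_lt]; omega

lemma zb_pascal {q : ℝ} (hq0 : 0 < q) (hq1 : q < 1) (N k : ℤ) (hN : 0 ≤ N) :
    zb q (N + 1) (k + 1) = zb q N k + q ^ (k + 1) * zb q N (k + 1) := by
  lift N to ℕ using hN
  rcases lt_trichotomy k (-1) with h | h | h
  · rw [zb_of q (by omega), zb_of q (by omega), zb_of q (by omega)]; ring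
  · subst h
    have e : (-1 : ℤ) + 1 = ((0 : ℕ) : ℤ) := by norm_num
    have e2 : (N : ℤ) + 1 = ((N + 1 : ℕ) : ℤ) := by push_cast; ring
    rw [zb_of (m := -1) q (by omega), e, e2, zb_nat, zb_nat, gb_zero hq0 hq1, gb_zero hq0 hq1]
    simp
  · obtain ⟨k, rfl⟩ := Int.eq_ofNat_of_zero_le (by omega : 0 ≤ k)
    have e2 : (N : ℤ) + 1 = ((N + 1 : ℕ) : ℤ) := by push_cast; ring
    have e3 : (k : ℤ) + 1 = ((k + 1 : ℕ) : ℤ) := by push_cast; ring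
    rw [e2, e3, zb_nat, zb_nat, zb_nat, gb_succ hq0 hq1, zpow_natCast]

/-- Burge transform. -/
lemma burge {q : ℝ} (hq0 : 0 < q) (hq1 : q < 1) (a b : ℕ) (A B : ℤ) (hAB : 0 ≤ A * B) :
    ∑ c ∈ Finset.range (b + 1), q ^ (((b : ℤ) - c) ^ 2) * zb q (a + c) (2 * b)
      * (zb q (b + A - B) (c + A) * zb q (b - A + B) (c - A))
    = q ^ (B ^ 2) * (zb q (a + A) (b + A + B) * zb q (a - A) (b - A - B)) := by
  have hAB' : (0 ≤ A ∧ 0 ≤ B) ∨ (A ≤ 0 ∧ B ≤ 0) := by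
    rcases mul_nonneg_iff.mp hAB with h | h <;> omega
  by_cases hz : 0 ≤ (b : ℤ) + A + B ∧ 0 ≤ (b : ℤ) - A - B ∧ (b : ℤ) + B ≤ a
  · obtain ⟨h1, h2, h3⟩ := hz
    obtain ⟨m, hm⟩ := Int.eq_ofNat_of_zero_le h1
    obtain ⟨n, hn⟩ := Int.eq_ofNat_of_zero_le h2
    obtain ⟨d, hd⟩ := Int.eq_ofNat_of_zero_le (by omega : 0 ≤ (a : ℤ) - b - B)
    obtain ⟨X, hX⟩ := Int.eq_ofNat_of_zero_le (by omega : 0 ≤ (b : ℤ) - A + B)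
    obtain ⟨Y, hY⟩ := Int.eq_ofNat_of_zero_le (by omega : 0 ≤ (b : ℤ) + A - B)
    have key := gb_knuth hq0 hq1 X Y m n d (by omega)
    have e1 : (a : ℤ) + A = ((m + d : ℕ) : ℤ) := by push_cast; omega
    have e2 : (a : ℤ) - A = ((X + d : ℕ) : ℤ) := by push_cast; omega
    have fin : ∀ k : ℕ, k < n + 1 → k ≤ X → n - k ≤ Y →
        q ^ (((b : ℤ) - (k + A)) ^ 2) * zb q (a + (k + A)) (2 * b)
          * (zb q Y (k + A + A) * zb q X (k + A - A)) =
        q ^ (B ^ 2) * (gb q X k * gb q Y (n - k) * gb q (m + d + k) (m + n)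
          * q ^ ((n - k) * (X - k))) := by
      intro k hk hkX hkY
      have e3 : (k : ℤ) + A + A = ((Y - (n - k) : ℕ) : ℤ) := by omega
      have e4 : (k : ℤ) + A - A = (k : ℤ) := by omega
      have e5 : gb q Y (Y - (n - k)) = gb q Y (n - k) := by
        obtain ⟨y, hy⟩ := Nat.exists_eq_add_of_le hkY
        have := gb_symm (q := q) (n - k) y
        rw [← hy] at this
        rw [this, hy]; congr 1; omega
      have e6 : ((b : ℤ) - (k + A)) ^ 2 = B ^ 2 + (((n - k) * (X - k) : ℕ) : ℤ) := by
        push_cast [Nat.cast_sub hkX, Nat.cast_sub (by omega : k ≤ n)]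
        rw [← hX, show (n : ℤ) = b - A - B from hn.symm]
        ring
      have e7 : (a : ℤ) + (k + A) = ((m + d + k : ℕ) : ℤ) := by push_cast; omega
      have e8 : 2 * (b : ℤ) = ((m + n : ℕ) : ℤ) := by push_cast; omega
      rw [e3, e4, e7, e8, zb_nat, zb_nat, zb_nat, e5, e6, zpow_add₀ hq0.ne', zpow_natCast]
      ring
    rw [e1, e2, hm, hn, zb_nat, zb_nat, ← key, hX, hY, Finset.mul_sum]
    refine Finset.sum_bij_ne_zero (fun c _ _ => ((c : ℤ) - A).toNat) ?_ ?_ ?_ ?_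
    · intro c hc h
      have hl := zb_bd (left_ne_zero_of_mul (right_ne_zero_of_mul h))
      have hr := zb_bd (right_ne_zero_of_mul (right_ne_zero_of_mul h))
      rw [Finset.mem_range]
      omega
    · intro c hc h c' hc' h' he
      have hr := zb_bd (right_ne_zero_of_mul (right_ne_zero_of_mul h))
      have hr' := zb_bd (right_ne_zero_of_mul (right_ne_zero_of_mul h'))
      omega
    · intro k hk h
      have hk : k < n + 1 := Finset.mem_range.mp hk
      have hg := left_ne_zero_of_mul (left_ne_zero_of_mul (right_ne_zero_of_mul h))
      have hY' : n - k ≤ Y := by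
        by_contra hh
        exact right_ne_zero_of_mul hg (gb_of_lt q (by omega))
      have hX' : k ≤ X := by
        by_contra hh
        exact left_ne_zero_of_mul hg (gb_of_lt q (by omega))
      have hpos : 0 ≤ (k : ℤ) + A := by omega
      refine ⟨((k : ℤ) + A).toNat, by rw [Finset.mem_range]; omega, ?_, by omega⟩
      rw [Int.toNat_of_nonneg hpos]
      rw [fin k hk hX' hY']
      exact h
    · intro c hc h
      have hl := zb_bd (left_ne_zero_of_mul (right_ne_zero_of_mul h))
      have hr := zb_bd (right_ne_zero_of_mul (right_ne_zero_of_mul h))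
      have ec : (c : ℤ) = ((((c : ℤ) - A).toNat : ℕ) : ℤ) + A := by omega
      have := fin (((c : ℤ) - A).toNat) (by omega) (by omega) (by omega)
      rw [← ec] at this
      exact this
  · have hR : zb q (a + A) (b + A + B) * zb q (a - A) (b - A - B) = 0 := by
      by_contra h
      have hl := zb_bd (left_ne_zero_of_mul h)
      have hr := zb_bd (right_ne_zero_of_mul h)
      omega
    rw [hR, mul_zero]
    refine Finset.sum_eq_zero fun c _ => ?_
    by_contra h
    have hl := zb_bd (left_ne_zero_of_mul (right_ne_zero_of_mul h))
    have hr := zb_bd (right_ne_zero_of_mul (right_ne_zero_of_mul h))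
    have h0 := zb_bd (right_ne_zero_of_mul (left_ne_zero_of_mul h))
    omega

/-- Final Vandermonde step. -/
lemma burge_last {q : ℝ} (hq0 : 0 < q) (hq1 : q < 1) (s : ℕ) (A B : ℤ) (hAB : 0 ≤ A * B) :
    ∑ c ∈ Finset.range (s + 1), q ^ (((s : ℤ) - c) ^ 2)
      * (zb q (s + A - B) (c + A) * zb q (s - A + B) (c - A))
    = q ^ (B ^ 2) * zb q (2 * s) (s - A - B) := by
  have hAB' : (0 ≤ A ∧ 0 ≤ B) ∨ (A ≤ 0 ∧ B ≤ 0) := by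
    rcases mul_nonneg_iff.mp hAB with h | h <;> omega
  by_cases hz : 0 ≤ (s : ℤ) + A + B ∧ 0 ≤ (s : ℤ) - A - B
  · obtain ⟨h1, h2⟩ := hz
    obtain ⟨n, hn⟩ := Int.eq_ofNat_of_zero_le h2
    obtain ⟨X, hX⟩ := Int.eq_ofNat_of_zero_le (by omega : 0 ≤ (s : ℤ) - A + B)
    obtain ⟨Y, hY⟩ := Int.eq_ofNat_of_zero_le (by omega : 0 ≤ (s : ℤ) + A - B)
    have key := gb_vand hq0 hq1 X Y n
    have e1 : 2 * (s : ℤ) = ((X + Y : ℕ) : ℤ) := by push_cast; omega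
    rw [e1, hn, zb_nat, ← key, hX, hY, Finset.mul_sum]
    have fin : ∀ k : ℕ, k < n + 1 → k ≤ X → n - k ≤ Y →
        q ^ (((s : ℤ) - (k + A)) ^ 2) * (zb q Y (k + A + A) * zb q X (k + A - A)) =
        q ^ (B ^ 2) * (gb q X k * gb q Y (n - k) * q ^ ((X - k) * (n - k))) := by
      intro k hk hkX hkY
      have e3 : (k : ℤ) + A + A = ((Y - (n - k) : ℕ) : ℤ) := by omega
      have e4 : (k : ℤ) + A - A = (k : ℤ) := by omega
      have e5 : gb q Y (Y - (n - k)) = gb q Y (n - k) := by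
        obtain ⟨y, hy⟩ := Nat.exists_eq_add_of_le hkY
        have := gb_symm (q := q) (n - k) y
        rw [← hy] at this
        rw [this, hy]; congr 1; omega
      have e6 : ((s : ℤ) - (k + A)) ^ 2 = B ^ 2 + (((X - k) * (n - k) : ℕ) : ℤ) := by
        push_cast [Nat.cast_sub hkX, Nat.cast_sub (by omega : k ≤ n)]
        rw [← hX, show (n : ℤ) = s - A - B from hn.symm]
        ring
      rw [e3, e4, zb_nat, zb_nat, e5, e6, zpow_add₀ hq0.ne', zpow_natCast]
      ring
    refine Finset.sum_bij_ne_zero (fun c _ _ => ((c : ℤ) - A).toNat) ?_ ?_ ?_ ?_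
    · intro c hc h
      have hl := zb_bd (left_ne_zero_of_mul (right_ne_zero_of_mul h))
      have hr := zb_bd (right_ne_zero_of_mul (right_ne_zero_of_mul h))
      rw [Finset.mem_range]
      omega
    · intro c hc h c' hc' h' he
      have hr := zb_bd (right_ne_zero_of_mul (right_ne_zero_of_mul h))
      have hr' := zb_bd (right_ne_zero_of_mul (right_ne_zero_of_mul h'))
      omega
    · intro k hk h
      have hk : k < n + 1 := Finset.mem_range.mp hk
      have hg := left_ne_zero_of_mul (right_ne_zero_of_mul h)
      have hY' : n - k ≤ Y := by
        by_contra hh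
        exact right_ne_zero_of_mul hg (gb_of_lt q (by omega))
      have hX' : k ≤ X := by
        by_contra hh
        exact left_ne_zero_of_mul hg (gb_of_lt q (by omega))
      have hpos : 0 ≤ (k : ℤ) + A := by omega
      refine ⟨((k : ℤ) + A).toNat, by rw [Finset.mem_range]; omega, ?_, by omega⟩
      rw [Int.toNat_of_nonneg hpos, fin k hk hX' hY']
      exact h
    · intro c hc h
      have hl := zb_bd (left_ne_zero_of_mul (right_ne_zero_of_mul h))
      have hr := zb_bd (right_ne_zero_of_mul (right_ne_zero_of_mul h))
      have ec : (c : ℤ) = ((((c : ℤ) - A).toNat : ℕ) : ℤ) + A := by omega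
      have := fin (((c : ℤ) - A).toNat) (by omega) (by omega) (by omega)
      rw [← ec] at this
      exact this
  · rw [zb_of q (by omega), mul_zero]
    refine Finset.sum_eq_zero fun c _ => ?_
    by_contra h
    have hl := zb_bd (left_ne_zero_of_mul (right_ne_zero_of_mul h))
    have hr := zb_bd (right_ne_zero_of_mul (right_ne_zero_of_mul h))
    omega

lemma sum_tele (f : ℤ → ℝ) (N : ℕ) (h1 : f (-N) = 0) (h2 : f (N + 1) = 0) :
    ∑ j ∈ Finset.Icc (-(N : ℤ)) N, (f j - f (j + 1)) = 0 := by
  rw [Finset.sum_sub_distrib]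
  have h3 : ∑ j ∈ Finset.Icc (-(N : ℤ)) N, f (j + 1)
      = ∑ j ∈ Finset.Icc (-(N : ℤ) + 1) (N + 1), f j := by
    rw [← Finset.map_add_right_Icc, Finset.sum_map]
    rfl
  have h4 : ∑ j ∈ Finset.Icc (-(N : ℤ)) (N + 1), f j = ∑ j ∈ Finset.Icc (-(N : ℤ)) N, f j := by
    symm
    refine Finset.sum_subset (Finset.Icc_subset_Icc le_rfl (by omega)) fun j hj hj' => ?_
    rw [Finset.mem_Icc] at hj hj'
    rw [show j = N + 1 by omega, h2]
  have h5 : ∑ j ∈ Finset.Icc (-(N : ℤ)) (N + 1), f j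
      = ∑ j ∈ Finset.Icc (-(N : ℤ) + 1) (N + 1), f j := by
    symm
    refine Finset.sum_subset (Finset.Icc_subset_Icc (by omega) le_rfl) fun j hj hj' => ?_
    rw [Finset.mem_Icc] at hj hj'
    rw [show j = -N by omega, h1]
  rw [h3, ← h4, h5, sub_self]

/-- The fermionic chain sums. -/
def EE (q : ℝ) : ℕ → ℕ → ℕ → ℝ
  | 0, a, b => if a = 0 ∧ b = 0 then 1 else 0
  | t + 1, a, b => ∑ c ∈ Finset.range (b + 1),
      q ^ (((b : ℤ) - c) ^ 2) * gb q (a + c) (2 * b) * EE q t b c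

lemma AB_nonneg (t : ℕ) (j : ℤ) : 0 ≤ (((t : ℤ) + 1) * j + 1) * j := by
  rcases lt_or_ge j 0 with h | h
  · refine mul_nonneg_of_nonpos_of_nonpos ?_ h.le
    have : (t : ℤ) * j ≤ 0 := mul_nonpos_of_nonneg_of_nonpos (by omega) h.le
    nlinarith
  · positivity

lemma EE_boson {q : ℝ} (hq0 : 0 < q) (hq1 : q < 1) (N t : ℕ) : ∀ a b : ℕ, b < N →
    EE q t a b = ∑ j ∈ Finset.Icc (-(N : ℤ)) N, q ^ (((t : ℤ) + 1) * j ^ 2 + j) *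
      (zb q (a + t * j) (b + (t + 1) * j) * zb q (a - t * j) (b - (t + 1) * j)
        - zb q (a + t * j + 1) (b + ((t + 1) * j + 1)) * zb q (a - t * j - 1) (b - ((t + 1) * j + 1)))
      := by
  induction t with
  | zero =>
    intro a b hb
    simp only [EE, Nat.cast_zero, zero_mul, zero_add, one_mul, add_zero, sub_zero]
    rcases Nat.eq_zero_or_pos a with ha | ha
    · subst ha
      have hz : ∀ k l : ℤ, zb q (((0 : ℕ) : ℤ) - 1) k = 0 := fun k _ => zb_of q (by omega)
      rw [Finset.sum_eq_single 0]
      · split_ifs with h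
        · have h00 : zb q 0 0 = 1 := by
            have := zb_nat q 0 0
            rw [gb_zero hq0 hq1] at this
            exact_mod_cast this
          rw [h.2, hz _ 0]
          simp [h00]
        · rw [hz _ 0, zb_of q (by omega)]; ring
      · intro j _ hj
        rw [hz _ 0]
        by_cases h : (b : ℤ) + j = 0
        · rw [zb_of (m := (b : ℤ) - j) q (by omega)]; ring
        · rw [zb_of (m := (b : ℤ) + j) q (by omega)]; ring
      · intro h; exact absurd (Finset.mem_Icc.mpr ⟨by omega, by omega⟩) h
    · rw [if_neg (by omega)]
      rw [← sum_tele (fun j => q ^ (j ^ 2 + b) * (zb q a (b + j) * zb q (a - 1) (b - j))) N]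
      · refine Finset.sum_congr rfl fun j _ => ?_
        have p1 := zb_pascal hq0 hq1 (a : ℤ) (b + j) (by omega)
        have p2 := zb_pascal hq0 hq1 ((a : ℤ) - 1) (b - j - 1) (by omega)
        rw [show (a : ℤ) - 1 + 1 = a by ring, show (b : ℤ) - j - 1 + 1 = b - j by ring] at p2
        rw [show (b : ℤ) + (j + 1) = b + j + 1 by ring, show (b : ℤ) - (j + 1) = b - j - 1 by ring,
          p1, p2, show (j + 1) ^ 2 + (b : ℤ) = (j ^ 2 + j) + (b + j + 1) by ring,
          show j ^ 2 + (b : ℤ) = (j ^ 2 + j) + (b - j) by ring, zpow_add₀ hq0.ne' (j ^ 2 + j),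
          zpow_add₀ hq0.ne' (j ^ 2 + j)]
        ring
      · rw [zb_of (m := (b : ℤ) + -N) q (by omega)]; ring
      · rw [zb_of (m := (b : ℤ) - (N + 1)) q (by omega)]; ring
  | succ t ih =>
    intro a b hb
    rw [EE]
    have h1 : ∀ c ∈ Finset.range (b + 1),
        q ^ (((b : ℤ) - c) ^ 2) * gb q (a + c) (2 * b) * EE q t b c
        = ∑ j ∈ Finset.Icc (-(N : ℤ)) N, q ^ (((t : ℤ) + 1) * j ^ 2 + j) *
          (q ^ (((b : ℤ) - c) ^ 2) * zb q (a + c) (2 * b) *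
            (zb q (b + t * j) (c + (t + 1) * j) * zb q (b - t * j) (c - (t + 1) * j))
          - q ^ (((b : ℤ) - c) ^ 2) * zb q (a + c) (2 * b) *
            (zb q (b + t * j + 1) (c + ((t + 1) * j + 1))
              * zb q (b - t * j - 1) (c - ((t + 1) * j + 1)))) := by
      intro c hc
      have hc : c < b + 1 := Finset.mem_range.mp hc
      have := zb_nat q (a + c) (2 * b)
      push_cast at this
      rw [ih b c (by omega), ← this, Finset.mul_sum]
      exact Finset.sum_congr rfl fun j _ => by ring
    rw [Finset.sum_congr rfl h1, Finset.sum_comm]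
    refine Finset.sum_congr rfl fun j _ => ?_
    rw [← Finset.mul_sum, Finset.sum_sub_distrib]
    have b1 := burge hq0 hq1 a b (((t : ℤ) + 1) * j) j
      (by rw [mul_assoc]; exact mul_nonneg (by positivity) (mul_self_nonneg j))
    have b2 := burge hq0 hq1 a b (((t : ℤ) + 1) * j + 1) j (AB_nonneg t j)
    rw [show (b : ℤ) + (t + 1) * j - j = b + t * j by ring,
      show (b : ℤ) - (t + 1) * j + j = b - t * j by ring] at b1
    rw [show (b : ℤ) + ((t + 1) * j + 1) - j = b + t * j + 1 by ring,
      show (b : ℤ) - ((t + 1) * j + 1) + j = b - t * j - 1 by ring] at b2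
    rw [b1, b2]
    push_cast
    rw [show ((t : ℤ) + 1 + 1) * j ^ 2 + j = ((t + 1) * j ^ 2 + j) + j ^ 2 by ring,
      zpow_add₀ hq0.ne' ((t + 1) * j ^ 2 + j),
      show (b : ℤ) + (t + 1) * j + j = b + (t + 1 + 1) * j by ring,
      show (b : ℤ) - (t + 1) * j - j = b - (t + 1 + 1) * j by ring,
      show (b : ℤ) + ((t + 1) * j + 1) + j = b + ((t + 1 + 1) * j + 1) by ring,
      show (b : ℤ) - ((t + 1) * j + 1) - j = b - ((t + 1 + 1) * j + 1) by ring,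
      show (a : ℤ) + ((t + 1) * j + 1) = a + (t + 1) * j + 1 by ring,
      show (a : ℤ) - ((t + 1) * j + 1) = a - (t + 1) * j - 1 by ring]
    ring

lemma KK_boson {q : ℝ} (hq0 : 0 < q) (hq1 : q < 1) (N t s : ℕ) (hs : s < N) :
    ∑ c ∈ Finset.range (s + 1), q ^ (((s : ℤ) - c) ^ 2) * EE q t s c
    = ∑ j ∈ Finset.Icc (-(N : ℤ)) N, q ^ (((t : ℤ) + 2) * j ^ 2 + j) *
      (zb q (2 * s) (s - (t + 2) * j) - zb q (2 * s) (s - ((t + 2) * j + 1))) := by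
  have h1 : ∀ c ∈ Finset.range (s + 1),
      q ^ (((s : ℤ) - c) ^ 2) * EE q t s c
      = ∑ j ∈ Finset.Icc (-(N : ℤ)) N, q ^ (((t : ℤ) + 1) * j ^ 2 + j) *
        (q ^ (((s : ℤ) - c) ^ 2) *
          (zb q (s + t * j) (c + (t + 1) * j) * zb q (s - t * j) (c - (t + 1) * j))
        - q ^ (((s : ℤ) - c) ^ 2) *
          (zb q (s + t * j + 1) (c + ((t + 1) * j + 1))
            * zb q (s - t * j - 1) (c - ((t + 1) * j + 1)))) := by
    intro c hc
    have hc : c < s + 1 := Finset.mem_range.mp hc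
    rw [EE_boson hq0 hq1 N t s c (by omega), Finset.mul_sum]
    exact Finset.sum_congr rfl fun j _ => by ring
  rw [Finset.sum_congr rfl h1, Finset.sum_comm]
  refine Finset.sum_congr rfl fun j _ => ?_
  rw [← Finset.mul_sum, Finset.sum_sub_distrib]
  have b1 := burge_last hq0 hq1 s (((t : ℤ) + 1) * j) j
    (by rw [mul_assoc]; exact mul_nonneg (by positivity) (mul_self_nonneg j))
  have b2 := burge_last hq0 hq1 s (((t : ℤ) + 1) * j + 1) j (AB_nonneg t j)
  rw [show (s : ℤ) + (t + 1) * j - j = s + t * j by ring,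
    show (s : ℤ) - (t + 1) * j + j = s - t * j by ring] at b1
  rw [show (s : ℤ) + ((t + 1) * j + 1) - j = s + t * j + 1 by ring,
    show (s : ℤ) - ((t + 1) * j + 1) + j = s - t * j - 1 by ring] at b2
  rw [b1, b2]
  rw [show ((t : ℤ) + 2) * j ^ 2 + j = ((t + 1) * j ^ 2 + j) + j ^ 2 by ring,
    zpow_add₀ hq0.ne' ((t + 1) * j ^ 2 + j),
    show (s : ℤ) - (t + 1) * j - j = s - (t + 2) * j by ring,
    show (s : ℤ) - ((t + 1) * j + 1) - j = s - ((t + 2) * j + 1) by ring]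
  ring

lemma qTri_eq {q : ℝ} (hq0 : 0 < q) (hq1 : q < 1) (L : ℕ) (D : ℤ) :
    qTri q 0 L (2 * D) = ∑ s ∈ Finset.range (L + 1),
      q ^ ((s : ℤ) ^ 2 - D ^ 2) * (gb q L (2 * s) * zb q (2 * s) (s - D)) := by
  unfold qTri
  have fin : ∀ j s : ℕ, (s : ℤ) = j + D → 0 ≤ (j : ℤ) + 2 * D → 2 * s ≤ L →
      q ^ ((j : ℤ) * ((j : ℤ) + 2 * D - 0)) * qPoch q L /
          (qPoch q j * qPoch q (((j : ℤ) + 2 * D).toNat)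
            * qPoch q (((L : ℤ) - 2 * j - 2 * D).toNat))
      = q ^ ((s : ℤ) ^ 2 - D ^ 2) * (gb q L (2 * s) * zb q (2 * s) (s - D)) := by
    intro j s h1 h2 h3
    obtain ⟨k, hk⟩ := Int.eq_ofNat_of_zero_le h2
    obtain ⟨d, hd⟩ := Nat.exists_eq_add_of_le h3
    have e1 : (L : ℤ) - 2 * j - 2 * D = (d : ℤ) := by omega
    have e2 : (s : ℤ) - D = (j : ℤ) := by omega
    have e3 : 2 * (s : ℤ) = ((j + k : ℕ) : ℤ) := by push_cast; omega
    have e4 : 2 * s = j + k := by omega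
    have e5 : (s : ℤ) ^ 2 - D ^ 2 = (j : ℤ) * ((j : ℤ) + 2 * D - 0) := by rw [h1]; ring
    rw [e1, e2, e3, zb_nat, e4, hd, gb_add, e4, gb_add, e5, hk]
    simp only [Int.toNat_natCast]
    have h1 := qPoch_ne hq0 hq1 j
    have h2 := qPoch_ne hq0 hq1 k
    have h3 := qPoch_ne hq0 hq1 d
    have h4 := qPoch_ne hq0 hq1 (j + k)
    field_simp
  have gbd : ∀ s : ℕ, gb q L (2 * s) * zb q (2 * s) (s - D) ≠ 0 →
      2 * s ≤ L ∧ 0 ≤ (s : ℤ) - D ∧ (s : ℤ) - D ≤ 2 * s := by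
    intro s h
    refine ⟨?_, zb_bd (right_ne_zero_of_mul h)⟩
    by_contra hh
    exact left_ne_zero_of_mul h (gb_of_lt q (by omega))
  split_ifs with hA
  · refine Finset.sum_bij_ne_zero (fun j _ _ => ((j : ℤ) + D).toNat) ?_ ?_ ?_ ?_
    · intro j _ h
      have hc := (ite_ne_right_iff.mp h).1
      rw [Finset.mem_range]; omega
    · intro j _ h j' _ h' he
      have hc := (ite_ne_right_iff.mp h).1
      have hc' := (ite_ne_right_iff.mp h').1
      omega
    · intro s hs h
      have hb := gbd s (right_ne_zero_of_mul h)
      have hs' : (((s : ℤ) - D).toNat : ℤ) = s - D := Int.toNat_of_nonneg hb.2.1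
      refine ⟨((s : ℤ) - D).toNat, by rw [Finset.mem_range]; omega, ?_, by omega⟩
      rw [if_pos (by omega), fin _ s (by omega) (by omega) (by omega)]
      exact h
    · intro j _ h
      have hc := (ite_ne_right_iff.mp h).1
      rw [if_pos hc]
      exact fin _ _ (by omega) hc.1 (by omega)
  · symm
    refine Finset.sum_eq_zero fun s _ => ?_
    by_contra h
    have hb := gbd s (right_ne_zero_of_mul h)
    rw [abs_le] at hA
    omega

lemma rhs_eq {q : ℝ} (hq0 : 0 < q) (hq1 : q < 1) (P L : ℕ) :
    ∑' j : ℤ,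
      (q ^ (((P + 4 : ℕ) : ℤ) * (((P + 4 : ℕ) : ℤ) + 1) * j ^ 2 + j)
          * qTri q 0 L (2 * ((P + 4 : ℕ) : ℤ) * j)
        - q ^ ((((P + 4 : ℕ) : ℤ) * j + 1) * ((((P + 4 : ℕ) : ℤ) + 1) * j + 1))
          * qTri q 0 L (2 * ((P + 4 : ℕ) : ℤ) * j + 2))
    = ∑ s ∈ Finset.range (L + 1), q ^ ((s : ℤ) ^ 2) * gb q L (2 * s) *
        ∑ c ∈ Finset.range (s + 1), q ^ (((s : ℤ) - c) ^ 2) * EE q (P + 2) s c := by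
  have hbig : ∀ j : ℤ, ¬ (j ∈ Finset.Icc (-((L + 1 : ℕ) : ℤ)) ((L + 1 : ℕ) : ℤ)) →
      ∀ e : ℤ, (e = 0 ∨ e = 2) → qTri q 0 L (2 * ((P + 4 : ℕ) : ℤ) * j + e) = 0 := by
    intro j hj e he
    unfold qTri
    rw [if_neg]
    rw [Finset.mem_Icc] at hj
    rw [abs_le]
    push_cast at hj ⊢
    intro hh
    have hP : (0 : ℤ) ≤ P := by omega
    rcases lt_or_ge j 0 with h | h
    · have : (P : ℤ) * j ≤ 0 := mul_nonpos_of_nonneg_of_nonpos hP h.le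
      have : 2 * ((P : ℤ) + 4) * j = 2 * (P * j) + 8 * j := by ring
      omega
    · have : 0 ≤ (P : ℤ) * j := mul_nonneg hP h
      have : 2 * ((P : ℤ) + 4) * j = 2 * (P * j) + 8 * j := by ring
      omega
  rw [tsum_eq_sum (s := Finset.Icc (-((L + 1 : ℕ) : ℤ)) ((L + 1 : ℕ) : ℤ))]
  · have h1 : ∀ s ∈ Finset.range (L + 1), q ^ ((s : ℤ) ^ 2) * gb q L (2 * s) *
        ∑ c ∈ Finset.range (s + 1), q ^ (((s : ℤ) - c) ^ 2) * EE q (P + 2) s c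
        = ∑ j ∈ Finset.Icc (-((L + 1 : ℕ) : ℤ)) ((L + 1 : ℕ) : ℤ),
          q ^ ((s : ℤ) ^ 2) * gb q L (2 * s) * (q ^ (((P : ℤ) + 4) * j ^ 2 + j) *
      (zb q (2 * s) (s - (P + 4) * j) - zb q (2 * s) (s - ((P + 4) * j + 1)))) := by
      intro s hs
      rw [KK_boson hq0 hq1 (L + 1) (P + 2) s (Finset.mem_range.mp hs), Finset.mul_sum]
      refine Finset.sum_congr rfl fun j _ => ?_
      have : (((P + 2 : ℕ) : ℤ) + 2) = P + 4 := by push_cast; ring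
      rw [this]
    rw [Finset.sum_congr rfl h1, Finset.sum_comm]
    refine Finset.sum_congr rfl fun j _ => ?_
    push_cast
    rw [show 2 * ((P : ℤ) + 4) * j = 2 * ((P + 4) * j) by ring, qTri_eq hq0 hq1,
      show 2 * (((P : ℤ) + 4) * j) + 2 = 2 * ((P + 4) * j + 1) by ring, qTri_eq hq0 hq1,
      Finset.mul_sum, Finset.mul_sum, ← Finset.sum_sub_distrib]
    refine Finset.sum_congr rfl fun s _ => ?_
    have e1 : q ^ (((P : ℤ) + 4) * (P + 4 + 1) * j ^ 2 + j) * q ^ ((s : ℤ) ^ 2 - ((P + 4) * j) ^ 2)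
        = q ^ ((s : ℤ) ^ 2) * q ^ (((P : ℤ) + 4) * j ^ 2 + j) := by
      rw [← zpow_add₀ hq0.ne', ← zpow_add₀ hq0.ne']; congr 1; ring
    have e2 : q ^ ((((P : ℤ) + 4) * j + 1) * ((P + 4 + 1) * j + 1))
          * q ^ ((s : ℤ) ^ 2 - ((P + 4) * j + 1) ^ 2)
        = q ^ ((s : ℤ) ^ 2) * q ^ (((P : ℤ) + 4) * j ^ 2 + j) := by
      rw [← zpow_add₀ hq0.ne', ← zpow_add₀ hq0.ne']; congr 1; ring
    linear_combination (gb q L (2 * s) * zb q (2 * s) (s - (P + 4) * j)) * e1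
      - (gb q L (2 * s) * zb q (2 * s) (s - ((P + 4) * j + 1))) * e2
  · intro j hj
    have h0 := hbig j hj 0 (Or.inl rfl)
    rw [add_zero] at h0
    rw [h0, hbig j hj 2 (Or.inr rfl)]
    ring

/-- The sequence `a, b, f 0, f 1, …, 0, 0, …`. -/
def lseq (a b : ℕ) {n : ℕ} (f : Fin n → ℕ) : ℕ → ℕ
  | 0 => a
  | 1 => b
  | i + 2 => if h : i < n then f ⟨i, h⟩ else 0

/-- Weight of a chain. -/
def wt (q : ℝ) (n : ℕ) (l : ℕ → ℕ) : ℝ :=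
  ∏ i ∈ Finset.range (n + 1),
    (q ^ (((l (i + 1) : ℤ) - l (i + 2)) ^ 2) * gb q (l i + l (i + 2)) (2 * l (i + 1)))

lemma wt_bd {q : ℝ} (n : ℕ) : ∀ l : ℕ → ℕ, wt q n l ≠ 0 → (∀ i, n + 2 ≤ i → l i = 0) →
    ∀ i, l (i + 1) ≤ l i := by
  induction n with
  | zero =>
    intro l h hl i
    have h2 := hl 2 le_rfl
    have h3 : 2 * l 1 ≤ l 0 + l 2 := by
      by_contra hh
      apply h
      simp [wt, gb_of_lt q (by omega : l 0 + l 2 < 2 * l 1)]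
    match i with
    | 0 => show l 1 ≤ l 0; omega
    | i + 1 => rw [hl (i + 1 + 1) (by omega)]; omega
  | succ n ih =>
    intro l h hl i
    unfold wt at h
    rw [Finset.prod_range_succ'] at h
    have ih' := ih (fun i => l (i + 1)) (left_ne_zero_of_mul h) (fun i hi => hl _ (by omega))
    have h3 : 2 * l 1 ≤ l 0 + l 2 := by
      by_contra hh
      exact right_ne_zero_of_mul (right_ne_zero_of_mul h) (gb_of_lt q (by simpa using hh))
    have h4 := ih' 0
    simp only [zero_add, Nat.reduceAdd] at h4
    match i with
    | 0 => show l 1 ≤ l 0; omega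
    | i + 1 => exact ih' i

lemma lseq_tail (a b : ℕ) {n : ℕ} (f : Fin n → ℕ) : ∀ i, n + 2 ≤ i → lseq a b f i = 0 := by
  intro i hi
  match i with
  | 0 => omega
  | 1 => omega
  | i + 2 => rw [lseq, dif_neg (by omega)]

lemma wt_le {q : ℝ} {n : ℕ} (a b : ℕ) (f : Fin n → ℕ) (h : wt q n (lseq a b f) ≠ 0) :
    b ≤ a ∧ ∀ i, f i ≤ a := by
  have h1 := wt_bd n _ h (lseq_tail a b f)
  have h2 : ∀ i, lseq a b f i ≤ a := by
    intro i
    induction i with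
    | zero => exact le_rfl
    | succ i ih => exact (h1 i).trans ih
  refine ⟨h2 1, fun i => ?_⟩
  have := h2 (i + 2)
  rwa [lseq, dif_pos i.2] at this

lemma wt_summable (q : ℝ) (n a b : ℕ) : Summable fun f : Fin n → ℕ => wt q n (lseq a b f) := by
  refine summable_of_hasFiniteSupport (Set.Finite.subset (Set.finite_Iic (fun _ => a)) ?_)
  intro f hf
  exact fun i => (wt_le a b f hf).2 i

lemma lseq_cons (a b c : ℕ) {n : ℕ} (g : Fin n → ℕ) :
    (fun i => lseq a b (Fin.cons c g : Fin (n + 1) → ℕ) (i + 1)) = lseq b c g := by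
  funext i
  match i with
  | 0 => rfl
  | 1 => rfl
  | i + 2 =>
    show lseq a b (Fin.cons c g : Fin (n + 1) → ℕ) (i + 1 + 2) = lseq b c g (i + 2)
    rw [lseq, lseq]
    by_cases h : i < n
    · rw [dif_pos h, dif_pos (by omega)]
      rfl
    · rw [dif_neg h, dif_neg (by omega)]

lemma wt_cons (q : ℝ) (a b c : ℕ) {n : ℕ} (g : Fin n → ℕ) :
    wt q (n + 1) (lseq a b (Fin.cons c g : Fin (n + 1) → ℕ))
      = q ^ (((b : ℤ) - c) ^ 2) * gb q (a + c) (2 * b) * wt q n (lseq b c g) := by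
  conv_lhs => unfold wt
  rw [Finset.prod_range_succ', mul_comm]
  congr 1
  rw [← lseq_cons a b c g]
  rfl

lemma EE_two {q : ℝ} (hq0 : 0 < q) (hq1 : q < 1) (a b : ℕ) :
    EE q 2 a b = q ^ ((b : ℤ) ^ 2) * gb q a (2 * b) := by
  have h1 : ∀ c, EE q 1 b c = if c = 0 then 1 else 0 := by
    intro c
    rw [EE]
    split_ifs with h
    · subst h; simp [EE, gb_zero hq0 hq1]
    · refine Finset.sum_eq_zero fun d _ => ?_
      rw [EE, if_neg (by omega), mul_zero]
  rw [EE, Finset.sum_eq_single 0]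
  · rw [h1]; simp
  · intro c _ hc
    rw [h1, if_neg hc, mul_zero]
  · simp

lemma wt_tsum {q : ℝ} (hq0 : 0 < q) (hq1 : q < 1) (n : ℕ) : ∀ a b : ℕ,
    ∑' f : Fin n → ℕ, wt q n (lseq a b f) = EE q (n + 2) a b := by
  induction n with
  | zero =>
    intro a b
    rw [EE_two hq0 hq1, tsum_fintype, Fintype.sum_unique]
    simp [wt, lseq]
  | succ n ih =>
    intro a b
    rw [← (Fin.consEquiv (fun _ : Fin (n + 1) => ℕ)).tsum_eq]
    have hs : Summable fun x : ℕ × (Fin n → ℕ) =>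
        wt q (n + 1) (lseq a b (Fin.consEquiv (fun _ : Fin (n + 1) => ℕ) x)) :=
      (wt_summable q (n + 1) a b).comp_injective
        (Fin.consEquiv (fun _ : Fin (n + 1) => ℕ)).injective
    rw [hs.tsum_prod]
    have h1 : ∀ c : ℕ, ∑' g : Fin n → ℕ,
        wt q (n + 1) (lseq a b (Fin.consEquiv (fun _ : Fin (n + 1) => ℕ) (c, g)))
        = q ^ (((b : ℤ) - c) ^ 2) * gb q (a + c) (2 * b) * EE q (n + 2) b c := by
      intro c
      rw [← ih, ← tsum_mul_left]
      exact tsum_congr fun g => wt_cons q a b c g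
    rw [tsum_congr h1, tsum_eq_sum (s := Finset.range (b + 1))]
    · rfl
    · intro c hc
      rw [Finset.mem_range] at hc
      rw [← ih]
      rw [tsum_congr (g := fun _ => (0 : ℝ)), tsum_zero, mul_zero]
      intro g
      by_contra hh
      have := (wt_le b c g hh).1
      omega

lemma EE_gt {q : ℝ} (hq0 : 0 < q) (hq1 : q < 1) (n a b : ℕ) (h : a < b) :
    EE q (n + 2) a b = 0 := by
  rw [← wt_tsum hq0 hq1, tsum_congr (g := fun _ => (0 : ℝ)), tsum_zero]
  intro g
  by_contra hh
  have := (wt_le a b g hh).1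
  omega

lemma qBinQ_int (q : ℝ) (N : ℤ) (m : ℕ) : qBinQ q (N : ℚ) m = zb q N m := by
  unfold qBinQ zb
  by_cases h : (m : ℤ) ≤ N
  · have h1 : (m : ℚ) ≤ (N : ℚ) := by exact_mod_cast h
    rw [if_pos ⟨by simp, h1⟩, if_pos ⟨by omega, h⟩]
    unfold gb
    rw [if_pos (by omega)]
    simp
  · have h1 : ¬ (m : ℚ) ≤ (N : ℚ) := by
      intro h'; exact h (by exact_mod_cast h')
    rw [if_neg (fun h' => h1 h'.2), if_neg (fun h' => h h'.2)]

/-- Extension by zero. -/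
def ext0 {n : ℕ} (m : Fin n → ℕ) (i : ℕ) : ℕ := if h : i < n then m ⟨i, h⟩ else 0

lemma ext0_val {n : ℕ} (m : Fin n → ℕ) (i : Fin n) : ext0 m i = m i := by
  unfold ext0; rw [dif_pos i.2]

/-- `Ĩ m` on sequences. -/
def RR (M : ℕ → ℕ) : ℕ → ℚ
  | 0 => - M 2
  | 1 => M 2
  | 2 => M 0 + M 1 + M 3
  | i + 3 => M (i + 2) + M (i + 4)

lemma ItM_sum (P : ℕ) (m : Fin (P + 4 - 1) → ℕ) (i : Fin (P + 4 - 1)) :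
    ∑ j, ItM (P + 4) i j * (m j : ℚ) = RR (ext0 m) i := by
  have hz : ∀ i, P + 3 ≤ i → ext0 m i = 0 := by
    intro i hi; unfold ext0; rw [dif_neg]; omega
  have key : ∀ (k : ℕ), ∑ j ∈ Finset.range (P + 3), (if j = k then (ext0 m j : ℚ) else 0)
      = ext0 m k := by
    intro k
    rw [Finset.sum_ite_eq']
    split_ifs with h
    · rfl
    · rw [hz k (by simpa using h)]; simp
  have h1 : ∑ j, ItM (P + 4) i j * (m j : ℚ) = ∑ j ∈ Finset.range (P + 3),
      (if i.val = 0 then (if j = 2 then (-1 : ℚ) else 0)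
        else if j = 0 then (if i.val = 2 then 1 else 0)
        else if i.val = j + 1 ∨ j = i.val + 1 then 1 else 0) * (ext0 m j : ℚ) := by
    have := Fin.sum_univ_eq_sum_range (fun j => (if i.val = 0 then (if j = 2 then (-1 : ℚ) else 0)
        else if j = 0 then (if i.val = 2 then 1 else 0)
        else if i.val = j + 1 ∨ j = i.val + 1 then 1 else 0) * (ext0 m j : ℚ)) (P + 3)
    rw [← this]
    refine Finset.sum_congr rfl fun j _ => ?_
    rw [← ext0_val m j]
    rfl
  rw [h1]
  obtain ⟨i, hi⟩ := i
  match i with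
  | 0 =>
    show _ = -(ext0 m 2 : ℚ)
    rw [← key, ← Finset.sum_neg_distrib]
    refine Finset.sum_congr rfl fun j _ => ?_
    split_ifs <;> simp_all
  | 1 =>
    show _ = (ext0 m 2 : ℚ)
    rw [← key]
    refine Finset.sum_congr rfl fun j _ => ?_
    simp only []
    split_ifs <;> first | contradiction | omega | simp
  | 2 =>
    show _ = (ext0 m 0 : ℚ) + ext0 m 1 + ext0 m 3
    rw [← key, ← key, ← key, ← Finset.sum_add_distrib, ← Finset.sum_add_distrib]
    refine Finset.sum_congr rfl fun j _ => ?_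
    simp only []
    split_ifs <;> first | contradiction | omega | simp
  | i + 3 =>
    show _ = (ext0 m (i + 2) : ℚ) + ext0 m (i + 4)
    rw [← key, ← key, ← Finset.sum_add_distrib]
    refine Finset.sum_congr rfl fun j _ => ?_
    simp only []
    split_ifs <;> first | contradiction | omega | simp

lemma topVec_eq (P L : ℕ) (m : Fin (P + 4 - 1) → ℕ) (i : Fin (P + 4 - 1)) :
    topVec (P + 4) L 0 m i = RR (ext0 m) i / 2 + if i.val = 0 then (L : ℚ) else 0 := by
  unfold topVec
  rw [ItM_sum]
  unfold evec
  simp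

lemma PhiQ_eq (P : ℕ) (m : Fin (P + 4 - 1) → ℕ) :
    PhiQ (P + 4) 0 m = (∑ i ∈ Finset.range (P + 3),
      (ext0 m i : ℚ) * (2 * ext0 m i - RR (ext0 m) i)) / 4 := by
  unfold PhiQ
  have := Fin.sum_univ_eq_sum_range
    (fun i => (ext0 m i : ℚ) * (2 * ext0 m i - RR (ext0 m) i)) (P + 3)
  rw [← this]
  simp only [Pi.zero_apply, zero_mul, Finset.sum_const_zero, zero_div, sub_zero]
  congr 1
  refine Finset.sum_congr rfl fun i _ => ?_
  have h2 : ∑ j, (m i : ℚ) * CtM (P + 4) i j * (m j : ℚ)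
      = (m i : ℚ) * (2 * m i - ∑ j, ItM (P + 4) i j * (m j : ℚ)) := by
    unfold CtM
    rw [mul_sub, Finset.mul_sum]
    have h3 : (m i : ℚ) * (2 * m i)
        = ∑ j, (m i : ℚ) * (if i = j then 2 else 0) * (m j : ℚ) := by
      rw [Finset.sum_eq_single i]
      · simp; ring
      · intro j _ hj; simp [hj.symm]
      · simp
    rw [h3, ← Finset.sum_sub_distrib]
    exact Finset.sum_congr rfl fun j _ => by ring
  have h4 := ItM_sum P m i
  rw [h2, h4, ← ext0_val m i]

/-- The full sequence of values of `m`. -/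
def Mseq (s k : ℕ) (l : ℕ → ℕ) : ℕ → ℕ
  | 0 => 2 * s - k
  | 1 => k
  | i + 2 => 2 * l (i + 1)

/-- Parametrisation of the relevant `m`. -/
def phiP (P : ℕ) (x : (Σ s : ℕ, Fin (2 * s + 1)) × (ℕ × (Fin P → ℕ))) : Fin (P + 4 - 1) → ℕ :=
  fun i => Mseq x.1.1 x.1.2 (lseq x.1.1 x.2.1 x.2.2) i

lemma ext0_phiP (P : ℕ) (x : (Σ s : ℕ, Fin (2 * s + 1)) × (ℕ × (Fin P → ℕ))) :
    ext0 (phiP P x) = Mseq x.1.1 x.1.2 (lseq x.1.1 x.2.1 x.2.2) := by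
  funext i
  unfold ext0
  split_ifs with h
  · rfl
  · obtain ⟨i, rfl⟩ : ∃ i', i = i' + 2 := ⟨i - 2, by omega⟩
    rw [Mseq, lseq_tail _ _ _ _ (by omega)]

lemma phiP_inj (P : ℕ) : Function.Injective (phiP P) := by
  rintro ⟨⟨s, k⟩, n, f⟩ ⟨⟨s', k'⟩, n', f'⟩ h
  have h' : ∀ i, Mseq s k (lseq s n f) i = Mseq s' k' (lseq s' n' f') i := by
    intro i
    have := congrArg (fun m => ext0 m i) h
    simpa [ext0_phiP] using this
  have h0 := h' 0
  have h1 := h' 1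
  have h2 := h' 2
  simp only [Mseq, lseq] at h0 h1 h2
  have hk := k.2
  have hk' := k'.2
  obtain rfl : s = s' := by omega
  obtain rfl : k = k' := Fin.ext h1
  obtain rfl : n = n' := by omega
  obtain rfl : f = f' := by
    funext i
    have := h' (i + 3)
    simp only [Mseq, lseq, dif_pos i.2] at this
    exact Nat.eq_of_mul_eq_mul_left (by omega) this
  rfl

/-- The prefactor. -/
def VV (q : ℝ) (L s k n : ℕ) : ℝ :=
  q ^ (2 * (s : ℤ) ^ 2 - 2 * s * k + (k : ℤ) ^ 2 - k * n + (n : ℤ) ^ 2)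
    * (zb q ((L : ℤ) - n) ((2 * s - k : ℕ) : ℤ) * gb q n k)

lemma quad_tele (l : ℕ → ℚ) (K : ℕ) :
    ∑ i ∈ Finset.range (K + 1), (l (i + 1) * (2 * l (i + 1) - l i - l (i + 2)))
      = - l 0 * l 1 + l 1 ^ 2 + ∑ i ∈ Finset.range K, (l (i + 1) - l (i + 2)) ^ 2
        + l (K + 1) ^ 2 - l (K + 1) * l (K + 2) := by
  induction K with
  | zero => simp; ring
  | succ K ih => rw [Finset.sum_range_succ, ih, Finset.sum_range_succ]; ring

/-- The summand. -/
def gg (q : ℝ) (P L : ℕ) (m : Fin (P + 4 - 1) → ℕ) : ℝ :=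
  if mlast (P + 4) m % 2 = 0 then
    q ^ ((PhiQ (P + 4) 0 m : ℝ)) * ∏ i, qBinQ q (topVec (P + 4) L 0 m i) (m i)
  else 0

lemma mlast_eq (P : ℕ) (m : Fin (P + 4 - 1) → ℕ) : mlast (P + 4) m = ext0 m (P + 2) := by
  unfold mlast ext0
  rw [dif_pos (by omega), dif_pos (by omega)]
  rfl

lemma prod_eq (q : ℝ) (P L : ℕ) (m : Fin (P + 4 - 1) → ℕ) :
    ∏ i, qBinQ q (topVec (P + 4) L 0 m i) (m i)
    = (∏ i ∈ Finset.range (P + 1), qBinQ q (RR (ext0 m) (i + 2) / 2) (ext0 m (i + 2)))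
      * qBinQ q (RR (ext0 m) 1 / 2) (ext0 m 1) * qBinQ q (RR (ext0 m) 0 / 2 + L) (ext0 m 0) := by
  have := Fin.prod_univ_eq_prod_range
    (fun i => qBinQ q (RR (ext0 m) i / 2 + if i = 0 then (L : ℚ) else 0) (ext0 m i)) (P + 3)
  rw [Finset.prod_range_succ', Finset.prod_range_succ'] at this
  simp only [Nat.add_eq_zero_iff, one_ne_zero, and_false, if_false, if_true, add_zero,
    zero_add] at this
  rw [← this]
  refine Finset.prod_congr rfl fun i _ => ?_
  rw [topVec_eq, ← ext0_val m i]

lemma gg_phi {q : ℝ} (hq0 : 0 < q) (P L : ℕ) (s : ℕ) (k : Fin (2 * s + 1)) (n : ℕ)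
    (f : Fin P → ℕ) :
    gg q P L (phiP P (⟨s, k⟩, (n, f))) = VV q L s k n * wt q P (lseq s n f) := by
  obtain ⟨k, hk⟩ := k
  unfold gg
  rw [mlast_eq, PhiQ_eq, prod_eq, ext0_phiP]
  set l := lseq s n f with hl
  have hl0 : l 0 = s := rfl
  have hl1 : l 1 = n := rfl
  have hlP : l (P + 2) = 0 := lseq_tail _ _ _ _ (by omega)
  simp only []
  rw [if_pos (by simp [Mseq])]
  have hR : ∀ i, RR (Mseq s k l) (i + 2) / 2 = (((l i + l (i + 2) : ℕ) : ℤ) : ℚ) := by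
    intro i
    match i with
    | 0 =>
      show (((2 * s - k : ℕ) : ℚ) + k + (2 * l 2 : ℕ)) / 2 = _
      rw [Nat.cast_sub (by omega), hl0]
      push_cast
      ring
    | i + 1 =>
      show (((2 * l (i + 1) : ℕ) : ℚ) + (2 * l (i + 3) : ℕ)) / 2 = _
      push_cast
      ring
  have hR1 : RR (Mseq s k l) 1 / 2 = ((n : ℤ) : ℚ) := by
    show ((2 * l 1 : ℕ) : ℚ) / 2 = _
    rw [hl1]; push_cast; ring
  have hR0 : RR (Mseq s k l) 0 / 2 + L = (((L : ℤ) - n : ℤ) : ℚ) := by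
    show -((2 * l 1 : ℕ) : ℚ) / 2 + L = _
    rw [hl1]; push_cast; ring
  have hprod : ∏ i ∈ Finset.range (P + 1),
      qBinQ q (RR (Mseq s k l) (i + 2) / 2) (Mseq s k l (i + 2))
      = ∏ i ∈ Finset.range (P + 1), gb q (l i + l (i + 2)) (2 * l (i + 1)) := by
    refine Finset.prod_congr rfl fun i _ => ?_
    rw [hR, qBinQ_int, zb_nat]
    rfl
  have hPhi : (∑ i ∈ Finset.range (P + 3),
      (Mseq s k l i : ℚ) * (2 * Mseq s k l i - RR (Mseq s k l) i)) / 4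
      = (((2 * (s : ℤ) ^ 2 - 2 * s * k + (k : ℤ) ^ 2 - k * n + (n : ℤ) ^ 2)
        + ∑ i ∈ Finset.range (P + 1), ((l (i + 1) : ℤ) - l (i + 2)) ^ 2 : ℤ) : ℚ) := by
    rw [Finset.sum_range_succ', Finset.sum_range_succ']
    have ht := quad_tele (fun i => (l i : ℚ)) P
    have hs : ∑ i ∈ Finset.range (P + 1), (Mseq s k l (i + 1 + 1) : ℚ)
        * (2 * Mseq s k l (i + 1 + 1) - RR (Mseq s k l) (i + 1 + 1))
        = 4 * ∑ i ∈ Finset.range (P + 1),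
          ((l (i + 1) : ℚ) * (2 * l (i + 1) - l i - l (i + 2))) := by
      rw [Finset.mul_sum]
      refine Finset.sum_congr rfl fun i _ => ?_
      have h1 := hR i
      have h2 : (Mseq s k l (i + 1 + 1) : ℚ) = 2 * l (i + 1) := by
        show ((2 * l (i + 1) : ℕ) : ℚ) = _
        push_cast; ring
      rw [h2]
      push_cast at h1
      linear_combination (-4 * (l (i + 1) : ℚ)) * h1
    have e1 : RR (Mseq s k l) (0 + 1) = 2 * n := by
      show ((2 * l 1 : ℕ) : ℚ) = _
      rw [hl1]; push_cast; ring
    have e0 : RR (Mseq s k l) 0 = - (2 * n) := by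
      show -((2 * l 1 : ℕ) : ℚ) = _
      rw [hl1]; push_cast; ring
    have f1 : (Mseq s k l (0 + 1) : ℚ) = k := rfl
    have f0 : (Mseq s k l 0 : ℚ) = 2 * s - k := by
      show ((2 * s - k : ℕ) : ℚ) = _
      rw [Nat.cast_sub (by omega)]; push_cast; ring
    rw [hs, ht, e1, e0, f1, f0]
    simp only [hl0, hl1, hlP]
    push_cast
    rw [Finset.sum_range_succ _ P, hlP]
    push_cast
    ring
  rw [hPhi, hprod, hR1, hR0, qBinQ_int, qBinQ_int]
  unfold VV wt
  rw [Finset.prod_mul_distrib]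
  have hz : ∀ S : Finset ℕ, ∏ i ∈ S, q ^ (((l (i + 1) : ℤ) - l (i + 2)) ^ 2)
      = q ^ (∑ i ∈ S, ((l (i + 1) : ℤ) - l (i + 2)) ^ 2) := by
    intro S
    induction S using Finset.induction_on with
    | empty => simp
    | insert a S ha ih => rw [Finset.prod_insert ha, Finset.sum_insert ha, ih, zpow_add₀ hq0.ne']
  rw [hz, Rat.cast_intCast, Real.rpow_intCast, zpow_add₀ hq0.ne']
  have g1 : zb q (n : ℤ) ((Mseq s k l 1 : ℕ) : ℤ) = gb q n k := zb_nat q n k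
  have g0 : Mseq s k l 0 = 2 * s - k := rfl
  rw [g1, g0]
  ring

lemma qBinQ_even {q : ℝ} {a m : ℕ} (h : qBinQ q ((a : ℚ) / 2) m ≠ 0) : a % 2 = 0 := by
  unfold qBinQ at h
  have hd := (ite_ne_right_iff.mp h).1.1
  have h1 : (((a : ℚ) / 2).num : ℚ) = (a : ℚ) / 2 := (Rat.den_eq_one_iff _).mp hd
  have h2 : (2 : ℚ) * (((a : ℚ) / 2).num : ℚ) = a := by rw [h1]; ring
  have h3 : 2 * ((a : ℚ) / 2).num = (a : ℤ) := by exact_mod_cast h2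
  omega

lemma gg_range (q : ℝ) (P L : ℕ) : Function.support (gg q P L) ⊆ Set.range (phiP P) := by
  intro m hm
  have hm' := ite_ne_right_iff.mp (show gg q P L m ≠ 0 from hm)
  obtain ⟨hlast, hne⟩ := hm'
  rw [mlast_eq] at hlast
  rw [prod_eq] at hne
  have hp := left_ne_zero_of_mul (left_ne_zero_of_mul (right_ne_zero_of_mul hne))
  rw [Finset.prod_ne_zero_iff] at hp
  set M := ext0 m with hM
  have hz : ∀ i, P + 3 ≤ i → M i = 0 := by
    intro i hi; rw [hM]; unfold ext0; rw [dif_neg]; omega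
  have h3 : ∀ i, i < P → (M (i + 2) + M (i + 4)) % 2 = 0 := by
    intro i hi
    have := hp (i + 1) (Finset.mem_range.mpr (by omega))
    have e : RR M (i + 1 + 2) = ((M (i + 2) + M (i + 4) : ℕ) : ℚ) := by
      show (M (i + 2) : ℚ) + M (i + 4) = _
      push_cast; ring
    rw [e] at this
    exact qBinQ_even this
  have h2 : (M 0 + M 1 + M 3) % 2 = 0 := by
    have := hp 0 (Finset.mem_range.mpr (by omega))
    have e : RR M (0 + 2) = ((M 0 + M 1 + M 3 : ℕ) : ℚ) := by
      show (M 0 : ℚ) + M 1 + M 3 = _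
      push_cast; ring
    rw [e] at this
    exact qBinQ_even this
  have hev : ∀ d, d ≤ P → M (P - d + 2) % 2 = 0 ∧ M (P - d + 3) % 2 = 0 := by
    intro d
    induction d with
    | zero => intro _; exact ⟨hlast, by rw [hz _ (by omega)]⟩
    | succ d ih =>
      intro hd
      have i1 := ih (by omega)
      have i2 := h3 (P - (d + 1)) (by omega)
      rw [show P - (d + 1) + 4 = P - d + 3 by omega] at i2
      rw [show P - (d + 1) + 3 = P - d + 2 by omega]
      exact ⟨by omega, i1.1⟩
  have hall : ∀ i, M (i + 2) % 2 = 0 := by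
    intro i
    by_cases hi : i ≤ P
    · have := (hev (P - i) (by omega)).1
      rwa [show P - (P - i) + 2 = i + 2 by omega] at this
    · rw [hz _ (by omega)]
  have hM3 := hall 1
  refine ⟨(⟨(M 0 + M 1) / 2, ⟨M 1, by simp only [Nat.reduceAdd] at hM3; omega⟩⟩,
    (M 2 / 2, fun i => M (i + 3) / 2)), ?_⟩
  funext i
  rw [← ext0_val (phiP _ _) i, ext0_phiP, ← ext0_val m i, ← hM]
  obtain ⟨i, hi⟩ := i
  simp only []
  match i with
  | 0 => simp only [Mseq]; simp only [Nat.reduceAdd] at hM3; omega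
  | 1 => rfl
  | 2 =>
    have := hall 0
    simp only [Mseq, lseq, zero_add] at this ⊢
    omega
  | i + 3 =>
    have := hall (i + 1)
    simp only [Mseq, lseq]
    rw [dif_pos (by omega)]
    rw [show i + 1 + 2 = i + 3 by ring] at this
    omega

lemma VV_sum {q : ℝ} (hq0 : 0 < q) (hq1 : q < 1) (L s n : ℕ) (hn : n ≤ s) :
    ∑ k ∈ Finset.range (2 * s + 1), VV q L s k n
      = q ^ ((s : ℤ) ^ 2) * q ^ (((s : ℤ) - n) ^ 2) * gb q L (2 * s) := by
  by_cases hL : n ≤ L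
  · obtain ⟨d, rfl⟩ := Nat.exists_eq_add_of_le hL
    rw [← gb_vand hq0 hq1 n d (2 * s), Finset.mul_sum]
    refine Finset.sum_congr rfl fun k hk => ?_
    have hk : k < 2 * s + 1 := Finset.mem_range.mp hk
    unfold VV
    rw [show ((n + d : ℕ) : ℤ) - n = (d : ℤ) by push_cast; ring, zb_nat]
    by_cases hkn : k ≤ n
    · have e : 2 * (s : ℤ) ^ 2 - 2 * s * k + (k : ℤ) ^ 2 - k * n + (n : ℤ) ^ 2
          = (s : ℤ) ^ 2 + ((s : ℤ) - n) ^ 2 + (((n - k) * (2 * s - k) : ℕ) : ℤ) := by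
        push_cast [Nat.cast_sub hkn, Nat.cast_sub (by omega : k ≤ 2 * s)]
        ring
      rw [e, zpow_add₀ hq0.ne', zpow_add₀ hq0.ne', zpow_natCast]
      ring
    · rw [gb_of_lt q (by omega : n < k)]; ring
  · rw [gb_of_lt q (by omega : L < 2 * s), mul_zero]
    refine Finset.sum_eq_zero fun k _ => ?_
    unfold VV
    rw [zb_of q (by omega)]
    ring

lemma lhs_eq {q : ℝ} (hq0 : 0 < q) (hq1 : q < 1) (P L : ℕ) :
    ∑' m, gg q P L m
    = ∑ s ∈ Finset.range (L + 1), q ^ ((s : ℤ) ^ 2) * gb q L (2 * s) *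
        ∑ c ∈ Finset.range (s + 1), q ^ (((s : ℤ) - c) ^ 2) * EE q (P + 2) s c := by
  rw [← (phiP_inj P).tsum_eq (gg_range q P L)]
  have hs : Summable fun x => gg q P L (phiP P x) := by
    refine summable_of_hasFiniteSupport
      (Set.Finite.subset ((Set.finite_Iic (fun _ => 2 * L)).preimage (phiP_inj P).injOn) ?_)
    rintro ⟨⟨s, k, hk⟩, n, f⟩ hx
    have hx : gg q P L (phiP P (⟨s, k, hk⟩, n, f)) ≠ 0 := hx
    rw [gg_phi hq0] at hx
    have hw := wt_le s n f (right_ne_zero_of_mul hx)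
    have hV := right_ne_zero_of_mul (left_ne_zero_of_mul hx)
    have hz := zb_bd (left_ne_zero_of_mul hV)
    have hg : k ≤ n := by
      by_contra hh
      exact right_ne_zero_of_mul hV (gb_of_lt q (by simpa using hh))
    simp only [] at hz
    have hsL : 2 * s ≤ L := by omega
    show phiP P (⟨s, k, hk⟩, n, f) ≤ fun _ => 2 * L
    intro i
    rw [← ext0_val (phiP P _) i, ext0_phiP]
    obtain ⟨i, hi⟩ := i
    simp only []
    match i with
    | 0 => simp only [Mseq]; omega
    | 1 => simp only [Mseq]; omega
    | 2 => simp only [Mseq, lseq]; omega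
    | i + 3 =>
      have hi' : i < P := by omega
      have := hw.2 ⟨i, hi'⟩
      simp only [Mseq, lseq, dif_pos hi']
      omega
  rw [hs.tsum_prod]
  have hin : ∀ y : (Σ s : ℕ, Fin (2 * s + 1)), ∑' z : ℕ × (Fin P → ℕ), gg q P L (phiP P (y, z))
      = ∑ n ∈ Finset.range (y.1 + 1), VV q L y.1 y.2 n * EE q (P + 2) y.1 n := by
    rintro ⟨s, k⟩
    have h1 := hs.prod_factor ⟨s, k⟩
    rw [h1.tsum_prod]
    have h2 : ∀ n : ℕ, ∑' f : Fin P → ℕ, gg q P L (phiP P (⟨s, k⟩, (n, f)))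
        = VV q L s k n * EE q (P + 2) s n := by
      intro n
      rw [← wt_tsum hq0 hq1, ← tsum_mul_left]
      exact tsum_congr fun f => gg_phi hq0 P L s k n f
    rw [tsum_congr h2, tsum_eq_sum (s := Finset.range (s + 1))]
    intro n hn
    rw [Finset.mem_range] at hn
    rw [EE_gt hq0 hq1 P s n (by omega), mul_zero]
  have hs2 := hs.prod
  rw [hs2.tsum_sigma]
  have hout : ∀ s : ℕ, ∑' k : Fin (2 * s + 1), ∑' z : ℕ × (Fin P → ℕ),
      gg q P L (phiP P (⟨s, k⟩, z)) = q ^ ((s : ℤ) ^ 2) * gb q L (2 * s) *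
        ∑ c ∈ Finset.range (s + 1), q ^ (((s : ℤ) - c) ^ 2) * EE q (P + 2) s c := by
    intro s
    rw [tsum_fintype, Finset.sum_congr rfl (fun k _ => hin ⟨s, k⟩)]
    show ∑ k : Fin (2 * s + 1), ∑ n ∈ Finset.range (s + 1), VV q L s k n * EE q (P + 2) s n = _
    rw [Finset.sum_comm, Finset.mul_sum]
    refine Finset.sum_congr rfl fun n hn => ?_
    have hn : n < s + 1 := Finset.mem_range.mp hn
    have := Fin.sum_univ_eq_sum_range (fun k => VV q L s k n) (2 * s + 1)
    rw [← Finset.sum_mul, this, VV_sum hq0 hq1 L s n (by omega)]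
    ring
  rw [tsum_congr hout, tsum_eq_sum (s := Finset.range (L + 1))]
  intro s hs
  rw [Finset.mem_range] at hs
  rw [gb_of_lt q (by omega : L < 2 * s)]
  ring

/-- Finitized identity for the vacuum character: for `p ≥ 4`, `L ≥ 0` and `0 < q < 1`,
`Σ_m q^{(m·C̃m)/4} ∏_j [(½Ĩm + L e₀)_j choose m_j]_q
  = Σ_{j∈ℤ} (q^{p(p+1)j²+j} T^0(L,2pj) - q^{(pj+1)((p+1)j+1)} T^0(L,2pj+2))`,
the left sum over all `m ∈ ℤ^{p-1}_{≥0}` with `m_{p-2}` even. -/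
theorem finitized_vacuum_identity (p : ℕ) (hp : 4 ≤ p) (L : ℕ)
    (q : ℝ) (hq0 : 0 < q) (hq1 : q < 1) :
    (∑' m : Fin (p - 1) → ℕ,
      if mlast p m % 2 = 0 then
        q ^ ((PhiQ p 0 m : ℝ)) * ∏ i, qBinQ q (topVec p L 0 m i) (m i)
      else 0)
      = ∑' j : ℤ,
          (q ^ ((p : ℤ) * ((p : ℤ) + 1) * j ^ 2 + j) * qTri q 0 L (2 * (p : ℤ) * j)
            - q ^ (((p : ℤ) * j + 1) * (((p : ℤ) + 1) * j + 1))
              * qTri q 0 L (2 * (p : ℤ) * j + 2)) := by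
  obtain ⟨P, rfl⟩ : ∃ P, p = P + 4 := ⟨p - 4, by omega⟩
  exact (lhs_eq hq0 hq1 P L).trans (rhs_eq hq0 hq1 P L).symm
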